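/- Corollary 2 (density of w-coprime ideal tuples): for integers w, m ≥ 1 with wm ≥ 2, lim_{n→∞} Q_{S,m}^w(n) / (j_S(n))^m = 1/ζ_S(wm), i.e., the probability that m random integral ideals of 𝒪_S of degree at most n are w-coprime tends to 1/ζ_S(wm). In particular, for m = 1, w = 2, the density of squarefree integral ideals of 𝒪_S is 1/ζ_S(2). -/

import Mathlib

section FunctionFieldModel

variable {Fq K Place : Type*} [Field Fq] [Fintype Fq] [Field K] [Algebra Fq K]

/-- The degree of a divisor `D = ∑ c_𝔭 𝔭` of the function field,
namely `∑ c_𝔭 deg 𝔭`. Divisors are modelled as finitely supported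
`ℤ`-valued functions on the type `Place` of prime divisors of `K`. -/
def divDeg (deg : Place → ℕ) (D : Place →₀ ℤ) : ℤ :=
  D.sum fun p n => n * (deg p : ℤ)

/-- The Riemann-Roch space `L(D) = {a ∈ K^× : (a) + D ≥ 0} ∪ {0}`,
where `prin u` is the principal divisor of the nonzero element `u`. -/
def Lset (prin : Kˣ → (Place →₀ ℤ)) (D : Place →₀ ℤ) : Set K :=
  {a : K | a = 0 ∨ ∃ u : Kˣ, (u : K) = a ∧ 0 ≤ prin u + D}

end FunctionFieldModel

/-- Integral ideals of `𝒪_S` (identified with effective divisors supported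
away from `S`) are `w`-coprime if no `𝔮^w` contains all of them. -/
def wCoprimeIdeals {Place : Type*} (S : Finset Place) (w : ℕ) {m : ℕ}
    (F : Fin m → (Place →₀ ℤ)) : Prop :=
  ¬ ∃ p : Place, p ∉ S ∧ ∀ l : Fin m, (w : ℤ) ≤ F l p

open Filter


section Aux

variable {Place : Type*} (deg : Place → ℕ)

lemma divDeg_add (D E : Place →₀ ℤ) : divDeg deg (D + E) = divDeg deg D + divDeg deg E := by
  unfold divDeg
  exact Finsupp.sum_add_index' (by simp) (by intros; ring)

lemma divDeg_zero : divDeg deg (0 : Place →₀ ℤ) = 0 := by simp [divDeg]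

/-- The degree as a group homomorphism. -/
def divDegHom : (Place →₀ ℤ) →+ ℤ where
  toFun := divDeg deg
  map_zero' := divDeg_zero deg
  map_add' := divDeg_add deg

lemma divDeg_neg (D : Place →₀ ℤ) : divDeg deg (-D) = - divDeg deg D :=
  (divDegHom deg).map_neg D

lemma divDeg_sub (D E : Place →₀ ℤ) : divDeg deg (D - E) = divDeg deg D - divDeg deg E :=
  (divDegHom deg).map_sub D E

lemma divDeg_single (p : Place) (c : ℤ) : divDeg deg (Finsupp.single p c) = c * deg p := by
  simp [divDeg]

lemma divDeg_nonneg {D : Place →₀ ℤ} (h : 0 ≤ D) : 0 ≤ divDeg deg D := by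
  unfold divDeg Finsupp.sum
  exact Finset.sum_nonneg fun p _ => mul_nonneg (h p) (by positivity)

lemma le_divDeg {D : Place →₀ ℤ} (h : 0 ≤ D) (p : Place) : D p * deg p ≤ divDeg deg D := by
  have h1 : 0 ≤ D - Finsupp.single p (D p) := by
    intro x
    by_cases hx : x = p
    · subst hx; simp
    · simpa [Finsupp.single_apply, Ne.symm hx] using h x
  have := divDeg_nonneg deg h1
  rw [divDeg_sub, divDeg_single] at this
  linarith

lemma eq_zero_of_divDeg (hdeg : ∀ p, 0 < deg p) {D : Place →₀ ℤ} (h : 0 ≤ D)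
    (h0 : divDeg deg D = 0) : D = 0 := by
  ext p
  have h1 := le_divDeg deg h p
  have h2 : 0 ≤ D p := h p
  have h3 : (0 : ℤ) < deg p := by exact_mod_cast hdeg p
  rw [h0] at h1
  simp only [Finsupp.coe_zero, Pi.zero_apply]
  nlinarith

/-- effective divisors of degree at most `n` -/
def effLe (n : ℤ) : Set (Place →₀ ℤ) := {D | 0 ≤ D ∧ divDeg deg D ≤ n}

lemma effLe_finite (hdeg : ∀ p, 0 < deg p) (hfin : ∀ n : ℕ, {p : Place | deg p ≤ n}.Finite)
    (n : ℤ) : (effLe deg n).Finite := by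
  classical
  set P := (hfin n.toNat).toFinset with hP
  set E : Place →₀ ℤ := ∑ p ∈ P, Finsupp.single p n with hE
  refine (Set.finite_Icc (0 : Place →₀ ℤ) E).subset ?_
  rintro D ⟨h0, hn⟩
  refine ⟨h0, fun p => ?_⟩
  have h1 := le_divDeg deg h0 p
  have h2 : 0 ≤ D p := h0 p
  have h3 : (0 : ℤ) < deg p := by exact_mod_cast hdeg p
  have hEp : E p = if p ∈ P then n else 0 := by
    simp [hE, Finsupp.finsetSum_apply, Finsupp.single_apply]
  rw [hEp]
  split_ifs with hp
  · nlinarith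
  · by_contra hc
    apply hp
    simp only [hP, Set.Finite.mem_toFinset, Set.mem_ofPred_eq]
    have : (deg p : ℤ) ≤ n := by nlinarith
    omega

/-- tuples of effective divisors of degree at most `n` -/
def tupLe (m : ℕ) (n : ℤ) : Set (Fin m → Place →₀ ℤ) := {F | ∀ l, F l ∈ effLe deg n}

lemma tupLe_finite (hdeg : ∀ p, 0 < deg p) (hfin : ∀ n : ℕ, {p : Place | deg p ≤ n}.Finite)
    (m : ℕ) (n : ℤ) : (tupLe deg m n).Finite := by
  have := Set.Finite.pi (ι := Fin m) (t := fun _ => effLe deg n) (fun _ => effLe_finite deg hdeg hfin n)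
  refine this.subset ?_
  intro F hF l _
  exact hF l

/-- the tuples in which all entries have multiplicity at least `w` at `p` -/
def badAt (m w : ℕ) (p : Place) : Set (Fin m → Place →₀ ℤ) := {F | ∀ l, (w : ℤ) ≤ F l p}

lemma ncard_bad {m : ℕ} (w : ℕ) (p : Place) (X : Set (Fin m → Place →₀ ℤ))
    (hX : ∀ F, (F + fun _ => Finsupp.single p (w : ℤ)) ∈ X ↔ F ∈ X) (n : ℤ) :
    (X ∩ tupLe deg m n ∩ badAt m w p).ncard = (X ∩ tupLe deg m (n - (w * deg p : ℕ))).ncard := by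
  classical
  have : X ∩ tupLe deg m n ∩ badAt m w p =
      (fun F => F + fun _ => Finsupp.single p (w : ℤ)) '' (X ∩ tupLe deg m (n - (w * deg p : ℕ))) := by
    ext F
    constructor
    · rintro ⟨⟨h1, h2⟩, h3⟩
      refine ⟨F - fun _ => Finsupp.single p (w : ℤ), ⟨?_, fun l => ⟨?_, ?_⟩⟩, ?_⟩
      · rw [← hX]; simpa using h1
      · intro x
        have a := (h2 l).1 x
        have b := h3 l
        by_cases hx : x = p
        · subst hx; simpa using b
        · simpa [Finsupp.single_apply, Ne.symm hx] using a
      · have := (h2 l).2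
        simp only [Pi.sub_apply, divDeg_sub, divDeg_single]
        push_cast; linarith
      · simp
    · rintro ⟨G, ⟨h1, h2⟩, rfl⟩
      refine ⟨⟨(hX G).2 h1, fun l => ⟨?_, ?_⟩⟩, fun l => ?_⟩
      · exact add_nonneg (h2 l).1 (by simp)
      · have := (h2 l).2
        simp only [Pi.add_apply, divDeg_add, divDeg_single]
        push_cast at this; linarith
      · have := (h2 l).1 p
        simpa using this
  rw [this]
  exact Set.ncard_image_of_injective _ (add_left_injective _)

/-- the tuples that are not bad at any `p` in `T` -/
def goodOn (m w : ℕ) (T : Set Place) : Set (Fin m → Place →₀ ℤ) := {F | ∀ p ∈ T, F ∉ badAt m w p}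

lemma goodOn_shift (m w w' : ℕ) (T : Set Place) (p : Place) (hp : p ∉ T)
    (F : Fin m → Place →₀ ℤ) :
    (F + fun _ => Finsupp.single p (w' : ℤ)) ∈ goodOn m w T ↔ F ∈ goodOn m w T := by
  classical
  unfold goodOn badAt
  simp only [Set.mem_ofPred_eq]
  refine forall₂_congr fun x hx => ?_
  have : p ≠ x := by rintro rfl; exact hp hx
  simp [this]

lemma limit_step {q d : ℕ} (hd : 0 < d) (hq : 2 ≤ q) (m e : ℕ) (he : d ∣ e) (f : ℤ → ℝ) (c : ℝ)
    (h : Filter.Tendsto (fun n : ℕ => f n / ((q : ℝ) ^ (d * (n / d))) ^ m) Filter.atTop (nhds c)) :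
    Filter.Tendsto (fun n : ℕ => (f n - f (n - e)) / ((q : ℝ) ^ (d * (n / d))) ^ m) Filter.atTop
      (nhds (c * (1 - ((q : ℝ) ^ (m * e))⁻¹))) := by
  have hq0 : (q : ℝ) ≠ 0 := by positivity
  have h2 : Filter.Tendsto (fun n : ℕ => f (n - e) / ((q : ℝ) ^ (d * (n / d))) ^ m) Filter.atTop
      (nhds (c * ((q : ℝ) ^ (m * e))⁻¹)) := by
    rw [← Filter.tendsto_add_atTop_iff_nat e]
    refine (h.mul_const _).congr fun n => ?_
    obtain ⟨k, rfl⟩ := he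
    rw [Nat.add_mul_div_left _ _ hd]
    push_cast
    rw [add_sub_cancel_right, mul_add, pow_add, mul_pow, ← pow_mul (q : ℝ) (d * k), mul_comm m]
    field_simp
  have := h.sub h2
  rw [mul_sub, mul_one]
  refine this.congr fun n => ?_
  ring

lemma limit_good (hdeg : ∀ p, 0 < deg p) (hfin : ∀ n : ℕ, {p : Place | deg p ≤ n}.Finite)
    {q d : ℕ} (hd : 0 < d) (hq : 2 ≤ q) (hdd : ∀ p, d ∣ deg p) (m w : ℕ)
    (X : Set (Fin m → Place →₀ ℤ)) (c : ℝ)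
    (h : Filter.Tendsto (fun n : ℕ => ((X ∩ tupLe deg m n).ncard : ℝ) /
      ((q : ℝ) ^ (d * (n / d))) ^ m) Filter.atTop (nhds c)) (T : Finset Place)
    (hX : ∀ p ∈ T, ∀ F, (F + fun _ => Finsupp.single p (w : ℤ)) ∈ X ↔ F ∈ X) :
    Filter.Tendsto (fun n : ℕ => ((X ∩ goodOn m w (T : Set Place) ∩ tupLe deg m n).ncard : ℝ) /
      ((q : ℝ) ^ (d * (n / d))) ^ m) Filter.atTop
      (nhds (c * ∏ p ∈ T, (1 - ((q : ℝ) ^ (w * m * deg p))⁻¹))) := by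
  classical
  induction T using Finset.induction_on with
  | empty => simpa [goodOn] using h
  | insert p T hp ih =>
    have ih := ih (fun x hx => hX x (Finset.mem_insert_of_mem hx))
    rw [Finset.prod_insert hp, mul_comm (1 - _), ← mul_assoc]
    have h1 := limit_step hd hq m (w * deg p) ((hdd p).mul_left _)
      (fun n : ℤ => ((X ∩ goodOn m w (T : Set Place) ∩ tupLe deg m n).ncard : ℝ)) _ ih
    rw [show m * (w * deg p) = w * m * deg p by ring] at h1
    refine h1.congr fun n => ?_
    congr 1
    rw [← ncard_bad deg w p (X ∩ goodOn m w (T : Set Place))]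
    · rw [sub_eq_iff_eq_add]
      norm_cast
      rw [← Set.ncard_inter_add_ncard_sdiff_eq_ncard (X ∩ goodOn m w (T : Set Place) ∩ tupLe deg m n) (badAt m w p)
        ((tupLe_finite deg hdeg hfin m n).subset Set.inter_subset_right), add_comm]
      congr 2
      ext F
      simp only [goodOn, Set.mem_sdiff, Set.mem_inter_iff, Set.mem_ofPred_eq, Finset.coe_insert,
        Set.mem_insert_iff, forall_eq_or_imp]
      tauto
    · intro F
      exact and_congr (hX p (Finset.mem_insert_self _ _) F)
        (goodOn_shift m w w _ p (by simpa using hp) F)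

end Aux

section RR

variable {Fq K Place : Type*} [Field K] (deg : Place → ℕ) (prin : Kˣ → (Place →₀ ℤ))

lemma prin_one (hmul : ∀ a b : Kˣ, prin (a * b) = prin a + prin b) : prin 1 = 0 := by
  have := hmul 1 1
  simpa using this

lemma prin_inv (hmul : ∀ a b : Kˣ, prin (a * b) = prin a + prin b) (u : Kˣ) :
    prin u⁻¹ = - prin u := by
  have := hmul u⁻¹ u
  rw [inv_mul_cancel, prin_one prin hmul] at this
  exact eq_neg_of_add_eq_zero_left this.symm

lemma card_units (q : ℕ) (hq : 2 ≤ q) (ell : (Place →₀ ℤ) → ℕ)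
    (hell : ∀ D : Place →₀ ℤ, Nat.card (Lset prin D) = q ^ ell D) (D : Place →₀ ℤ) :
    {u : Kˣ | 0 ≤ prin u + D}.ncard + 1 = q ^ ell D := by
  have h1 : Lset prin D = insert 0 ((fun u : Kˣ => (u : K)) '' {u : Kˣ | 0 ≤ prin u + D}) := by
    ext a
    constructor
    · rintro (h | ⟨u, rfl, h⟩)
      · exact Or.inl h
      · exact Or.inr ⟨u, h, rfl⟩
    · rintro (h | ⟨u, h, rfl⟩)
      · exact Or.inl h
      · exact Or.inr ⟨u, rfl, h⟩
  have hf : (Lset prin D).Finite := by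
    apply Nat.finite_of_card_ne_zero
    rw [hell]; positivity
  rw [← hell, Nat.card_coe_set_eq]
  rw [h1] at hf ⊢
  rw [Set.ncard_insert_of_notMem ?_ (hf.subset (Set.subset_insert _ _)), Set.ncard_image_of_injective _ Units.val_injective]
  · rintro ⟨u, _, hu⟩
    exact u.ne_zero hu

lemma card_class (hmul : ∀ a b : Kˣ, prin (a * b) = prin a + prin b) (D : Place →₀ ℤ) :
    {u : Kˣ | 0 ≤ prin u + D}.ncard =
      {E : Place →₀ ℤ | 0 ≤ E ∧ ∃ u, E = prin u + D}.ncard * {u : Kˣ | prin u = 0}.ncard := by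
  rw [← Nat.card_coe_set_eq, ← Nat.card_coe_set_eq, ← Nat.card_coe_set_eq, ← Nat.card_prod]
  symm
  choose! f hf using fun (E : Place →₀ ℤ) (h : 0 ≤ E ∧ ∃ u, E = prin u + D) => h.2
  refine Nat.card_congr (Equiv.ofBijective
    (fun x => ⟨f x.1.1 * x.2.1, ?_⟩) ⟨?_, ?_⟩)
  · have h1 := hf x.1.1 x.1.2
    have h2 : prin x.2.1 = 0 := x.2.2
    have h3 : 0 ≤ x.1.1 := x.1.2.1
    change 0 ≤ prin _ + D
    rw [hmul, h2, add_zero, ← h1]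
    exact h3
  · rintro ⟨⟨E, hE⟩, ⟨v, hv⟩⟩ ⟨⟨E', hE'⟩, ⟨v', hv'⟩⟩ h
    simp only [Subtype.mk.injEq] at h
    have hv : prin v = 0 := hv
    have hv' : prin v' = 0 := hv'
    have h1 := hf E hE
    have h2 := hf E' hE'
    have h3 := congrArg prin h
    rw [hmul, hmul, hv, hv', add_zero, add_zero] at h3
    have : E = E' := by rw [h1, h2, h3]
    subst this
    have := mul_left_cancel h
    subst this
    rfl
  · rintro ⟨u, hu⟩
    have hE : 0 ≤ prin u + D ∧ ∃ v, prin u + D = prin v + D := ⟨hu, u, rfl⟩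
    have h1 := hf _ hE
    refine ⟨⟨⟨prin u + D, hE⟩, ⟨(f (prin u + D))⁻¹ * u, ?_⟩⟩, ?_⟩
    · change prin _ = 0
      rw [hmul, prin_inv prin hmul, ← add_right_cancel h1]
      simp
    · simp

/-- effective divisors of degree exactly `n` -/
def effEq (n : ℤ) : Set (Place →₀ ℤ) := {D | 0 ≤ D ∧ divDeg deg D = n}

lemma effEq_finite (hdeg : ∀ p, 0 < deg p) (hfin : ∀ n : ℕ, {p : Place | deg p ≤ n}.Finite)
    (n : ℤ) : (effEq deg n).Finite :=
  (effLe_finite deg hdeg hfin n).subset fun _ h => ⟨h.1, h.2.le⟩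

lemma ell_big (q : ℕ) (hq : 2 ≤ q)
    (hdegprin : ∀ u : Kˣ, divDeg deg (prin u) = 0)
    (ell : (Place →₀ ℤ) → ℕ)
    (hell : ∀ D : Place →₀ ℤ, Nat.card (Lset prin D) = q ^ ell D)
    (g : ℕ) (Can : Place →₀ ℤ)
    (hRR : ∀ D : Place →₀ ℤ,
      (ell D : ℤ) = divDeg deg D - g + 1 + ell (Can - D))
    (hCan : divDeg deg Can = 2 * (g : ℤ) - 2) (D : Place →₀ ℤ) (hD : 2 * (g : ℤ) - 2 < divDeg deg D) :
    (ell D : ℤ) = divDeg deg D - g + 1 := by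
  have h1 := card_units prin q hq ell hell (Can - D)
  have h2 : {u : Kˣ | 0 ≤ prin u + (Can - D)} = ∅ := by
    ext u
    simp only [Set.mem_ofPred_eq, Set.mem_empty_iff_false, iff_false]
    intro h
    have := divDeg_nonneg deg h
    rw [divDeg_add, hdegprin, divDeg_sub] at this
    linarith
  rw [h2, Set.ncard_empty, zero_add] at h1
  have h3 : ell (Can - D) = 0 := by
    by_contra h
    have := Nat.one_lt_pow h (by omega : 1 < q)
    omega
  rw [hRR D, h3]; simp

lemma exists_card_effEq (hdeg : ∀ p, 0 < deg p)
    (hfin : ∀ n : ℕ, {p : Place | deg p ≤ n}.Finite) (q : ℕ) (hq : 2 ≤ q)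
    (hmul : ∀ a b : Kˣ, prin (a * b) = prin a + prin b)
    (hdegprin : ∀ u : Kˣ, divDeg deg (prin u) = 0)
    (ell : (Place →₀ ℤ) → ℕ)
    (hell : ∀ D : Place →₀ ℤ, Nat.card (Lset prin D) = q ^ ell D)
    (g : ℕ) (Can : Place →₀ ℤ)
    (hRR : ∀ D : Place →₀ ℤ,
      (ell D : ℤ) = divDeg deg D - g + 1 + ell (Can - D))
    (hCan : divDeg deg Can = 2 * (g : ℤ) - 2)
    (d : ℕ) (hd : 0 < d) (D₀ : Place →₀ ℤ) (hD₀ : divDeg deg D₀ = d) :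
    ∃ h b : ℕ, 0 < h ∧ 0 < b ∧ ∀ k : ℕ, 2 * g + 1 ≤ k →
      ∃ e : ℕ, e + g = d * k + 1 ∧ (effEq deg ((d * k : ℕ) : ℤ)).ncard * b + h = h * q ^ e := by
  classical
  let ph : Additive Kˣ →+ (Place →₀ ℤ) :=
    { toFun := fun u => prin u.toMul
      map_zero' := prin_one prin hmul
      map_add' := fun a b => hmul _ _ }
  have hph : ∀ x, x ∈ ph.range ↔ ∃ u, x = prin u := by
    intro x
    constructor
    · rintro ⟨u, rfl⟩; exact ⟨u.toMul, rfl⟩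
    · rintro ⟨u, rfl⟩; exact ⟨Additive.ofMul u, rfl⟩
  let mk : (Place →₀ ℤ) → (Place →₀ ℤ) ⧸ ph.range := fun D => (D : (Place →₀ ℤ) ⧸ ph.range)
  have hmk : ∀ D E, mk D = mk E ↔ ∃ u, D = prin u + E := by
    intro D E
    have : mk D = mk E ↔ -E + D ∈ ph.range := by
      rw [eq_comm]; exact QuotientAddGroup.eq
    rw [this, hph]
    refine exists_congr fun u => ?_
    rw [neg_add_eq_iff_eq_add, add_comm]
  let Cl : Set ((Place →₀ ℤ) ⧸ ph.range) := mk '' {D | divDeg deg D = 0}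
  let φ : ℕ → (Place →₀ ℤ) → (Place →₀ ℤ) ⧸ ph.range := fun k D => mk (D - k • D₀)
  have hkD : ∀ k : ℕ, divDeg deg (k • D₀) = (d * k : ℕ) := by
    intro k
    have := (divDegHom deg).map_nsmul k D₀
    change divDeg deg (k • D₀) = k • divDeg deg D₀ at this
    rw [this, hD₀]; push_cast; simp [mul_comm]
  have hmaps : ∀ k, ∀ E ∈ effEq deg ((d * k : ℕ) : ℤ), φ k E ∈ Cl := by
    intro k E hE
    refine ⟨_, ?_, rfl⟩
    change divDeg deg _ = 0
    rw [divDeg_sub, hkD, hE.2, sub_self]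
  have hfib : ∀ k D, divDeg deg D = 0 →
      {E | E ∈ effEq deg ((d * k : ℕ) : ℤ) ∧ φ k E = mk D} =
      {E : Place →₀ ℤ | 0 ≤ E ∧ ∃ u, E = prin u + (D + k • D₀)} := by
    intro k D hD
    ext E
    simp only [Set.mem_ofPred_eq, φ, hmk]
    constructor
    · rintro ⟨h1, u, hu⟩
      refine ⟨h1.1, u, ?_⟩
      rw [← add_assoc, ← hu]; simp
    · rintro ⟨h1, u, hu⟩
      refine ⟨⟨h1, ?_⟩, u, ?_⟩
      · rw [hu, divDeg_add, divDeg_add, hdegprin, hD, hkD]; simp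
      · rw [hu]; abel
  have hU : {u : Kˣ | prin u = 0} = {u : Kˣ | 0 ≤ prin u + 0} := by
    ext u
    simp only [Set.mem_ofPred_eq, add_zero]
    constructor
    · intro h; rw [h]
    · intro h; exact eq_zero_of_divDeg deg hdeg h (hdegprin u)
  have hUpos : 0 < {u : Kˣ | prin u = 0}.ncard := by
    have h1 := card_units prin q hq ell hell 0
    rw [← hU] at h1
    have hf : (Lset prin 0).Finite := by
      apply Nat.finite_of_card_ne_zero
      rw [hell]; positivity
    have hUf : {u : Kˣ | prin u = 0}.Finite := by
      apply Set.Finite.of_finite_image (f := fun u : Kˣ => (u : K)) _ Units.val_injective.injOn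
      refine hf.subset ?_
      rintro _ ⟨u, hu, rfl⟩
      rw [hU] at hu
      exact Or.inr ⟨u, rfl, hu⟩
    rw [Set.ncard_pos hUf]
    exact ⟨1, prin_one prin hmul⟩
  have hfibcard : ∀ k : ℕ, 2 * g + 1 ≤ k → ∀ c ∈ Cl, ∃ e : ℕ, e + g = d * k + 1 ∧
      {E | E ∈ effEq deg ((d * k : ℕ) : ℤ) ∧ φ k E = c}.ncard * {u : Kˣ | prin u = 0}.ncard + 1
        = q ^ e := by
    rintro k hk _ ⟨D, hD, rfl⟩
    have hD : divDeg deg D = 0 := hD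
    have hkk : k ≤ d * k := Nat.le_mul_of_pos_left k hd
    have hdg : divDeg deg (D + k • D₀) = (d * k : ℕ) := by rw [divDeg_add, hD, hkD, zero_add]
    have h1 := ell_big deg prin q hq hdegprin ell hell g Can hRR hCan (D + k • D₀)
      (by rw [hdg]; omega)
    refine ⟨ell (D + k • D₀), ?_, ?_⟩
    · rw [hdg] at h1; omega
    · rw [hfib k D hD, ← card_class prin hmul, card_units prin q hq ell hell]
  have hClfin : Cl.Finite := by
    refine ((effEq_finite deg hdeg hfin ((d * (2 * g + 1) : ℕ) : ℤ)).image (φ (2 * g + 1))).subset ?_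
    intro c hc
    obtain ⟨e, he, h1⟩ := hfibcard _ le_rfl c hc
    have he0 : e ≠ 0 := by
      have : 2 * g + 1 ≤ d * (2 * g + 1) := Nat.le_mul_of_pos_left _ hd
      omega
    have h2 := Nat.one_lt_pow he0 (by omega : 1 < q)
    have h3 : {E | E ∈ effEq deg ((d * (2 * g + 1) : ℕ) : ℤ) ∧ φ (2 * g + 1) E = c}.ncard ≠ 0 := by
      intro h; rw [h] at h1; omega
    obtain ⟨E, hE1, hE2⟩ := Set.nonempty_of_ncard_ne_zero h3
    exact ⟨E, hE1, hE2⟩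
  refine ⟨Cl.ncard, {u : Kˣ | prin u = 0}.ncard, ?_, hUpos, ?_⟩
  · rw [Set.ncard_pos hClfin]
    exact ⟨mk 0, 0, divDeg_zero deg, rfl⟩
  · intro k hk
    have hkk : k ≤ d * k := Nat.le_mul_of_pos_left k hd
    refine ⟨d * k + 1 - g, by omega, ?_⟩
    have hfe := effEq_finite deg hdeg hfin ((d * k : ℕ) : ℤ)
    have h1 := Finset.card_eq_sum_card_fiberwise (s := hfe.toFinset) (t := hClfin.toFinset)
      (f := φ k) (by
        intro E hE
        simp only [Set.Finite.coe_toFinset] at hE ⊢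
        exact hmaps k E hE)
    rw [Set.ncard_eq_toFinset_card _ hfe, Set.ncard_eq_toFinset_card _ hClfin, h1, Finset.sum_mul,
      Finset.card_eq_sum_ones, ← Finset.sum_add_distrib, Finset.sum_mul]
    refine Finset.sum_congr rfl fun c hc => ?_
    obtain ⟨e, he, h2⟩ := hfibcard k hk c (by simpa using hc)
    rw [show d * k + 1 - g = e by omega, one_mul, ← h2]
    congr 2
    rw [← Set.ncard_coe_finset]
    congr 1
    ext E
    simp

end RR

section Limits

open Filter

lemma exists_index {Place : Type*} (deg : Place → ℕ) (hdeg : ∀ p, 0 < deg p) (p₀ : Place) :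
    ∃ d : ℕ, 0 < d ∧ (∃ D₀, divDeg deg D₀ = d) ∧ ∀ D, (d : ℤ) ∣ divDeg deg D := by
  obtain ⟨a, ha⟩ := Int.subgroup_cyclic (divDegHom deg).range
  have hmem : ∀ x, x ∈ (divDegHom deg).range ↔ a ∣ x := by
    intro x
    rw [ha, ← AddSubgroup.zmultiples_eq_closure, Int.mem_zmultiples_iff]
  have hdvd : ∀ D, a ∣ divDeg deg D := fun D => (hmem _).1 ⟨D, rfl⟩
  refine ⟨a.natAbs, ?_, ?_, ?_⟩
  · rw [Int.natAbs_pos]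
    rintro rfl
    have := hdvd (Finsupp.single p₀ 1)
    rw [zero_dvd_iff, divDeg_single] at this
    have := hdeg p₀
    omega
  · have : ((a.natAbs : ℕ) : ℤ) ∈ (divDegHom deg).range := (hmem _).2 Int.dvd_natAbs_self
    obtain ⟨D, hD⟩ := this
    exact ⟨D, hD⟩
  · intro D
    exact Int.natAbs_dvd.2 (hdvd D)

lemma card_effLe {Place : Type*} (deg : Place → ℕ) (hdeg : ∀ p, 0 < deg p)
    (hfin : ∀ n : ℕ, {p : Place | deg p ≤ n}.Finite) (d : ℕ) (hd : 0 < d)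
    (hdd : ∀ D, (d : ℤ) ∣ divDeg deg D) (n : ℕ) :
    (effLe deg n).ncard = ∑ k ∈ Finset.range (n / d + 1), (effEq deg ((d * k : ℕ) : ℤ)).ncard := by
  classical
  have hf := effLe_finite deg hdeg hfin n
  rw [Set.ncard_eq_toFinset_card _ hf]
  rw [Finset.card_eq_sum_card_fiberwise (f := fun D => (divDeg deg D / d).toNat)
    (t := Finset.range (n / d + 1))]
  · refine Finset.sum_congr rfl fun k hk => ?_
    rw [← Set.ncard_coe_finset]
    congr 1
    ext D
    simp only [Finset.coe_filter, Set.Finite.mem_toFinset, effLe, effEq, Set.mem_ofPred_eq]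
    obtain ⟨c, hc⟩ := hdd D
    have hd' : (d : ℤ) ≠ 0 := by positivity
    have hkn : d * k ≤ n := by
      have := Finset.mem_range.1 hk
      calc d * k ≤ d * (n / d) := Nat.mul_le_mul_left _ (by omega)
        _ ≤ n := Nat.mul_div_le n d
    rw [hc, Int.mul_ediv_cancel_left _ hd']
    constructor
    · rintro ⟨⟨h0, h1⟩, h2⟩
      have h3 := divDeg_nonneg deg h0
      rw [hc] at h3
      have : 0 ≤ c := by
        by_contra hcc
        have : (0 : ℤ) < d := by positivity
        nlinarith
      refine ⟨h0, ?_⟩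
      have : c = k := by omega
      rw [this]; push_cast; ring
    · rintro ⟨h0, h1⟩
      push_cast at h1
      have : c = k := mul_left_cancel₀ hd' h1
      refine ⟨⟨h0, ?_⟩, by omega⟩
      rw [this]; exact_mod_cast hkn
  · intro D hD
    simp only [Set.Finite.coe_toFinset] at hD
    simp only [Finset.coe_range, Set.mem_Iio]
    have h1 := hD.2
    have : divDeg deg D / d ≤ (n : ℤ) / d := Int.ediv_le_ediv (by positivity) h1
    have h2 : 0 ≤ (n : ℤ) / d := by positivity
    omega

lemma sum_limit (Q : ℝ) (hQ : 1 < Q) (a : ℕ → ℝ) (c : ℝ)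
    (h : Tendsto (fun k => a k / Q ^ k) atTop (nhds c)) :
    Tendsto (fun k => (∑ i ∈ Finset.range (k + 1), a i) / Q ^ k) atTop (nhds (c * (Q / (Q - 1)))) := by
  have hQ0 : 0 < Q := by linarith
  have hQ1 : Q - 1 ≠ 0 := by linarith
  have h1 : (fun k => a k - c * Q ^ k) =o[atTop] (fun k => Q ^ k) := by
    rw [Asymptotics.isLittleO_iff_tendsto (fun k hk => absurd hk (by positivity))]
    have := h.sub_const c
    rw [sub_self] at this
    refine this.congr fun k => ?_
    field_simp
  have hgeo : ∀ k, ∑ i ∈ Finset.range k, Q ^ i = (Q ^ k - 1) / (Q - 1) := fun k =>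
    geom_sum_eq (by linarith) k
  have hinf : Tendsto (fun k => ∑ i ∈ Finset.range k, Q ^ i) atTop atTop := by
    simp only [hgeo]
    exact (tendsto_atTop_add_const_right _ _ (tendsto_pow_atTop_atTop_of_one_lt hQ)).atTop_div_const
      (by linarith)
  have h2 := h1.sum_range (fun k => by positivity) hinf
  have hG : Tendsto (fun k => (∑ i ∈ Finset.range (k + 1), Q ^ i) / Q ^ k) atTop
      (nhds (Q / (Q - 1))) := by
    have h3 : Tendsto (fun k : ℕ => (Q - (Q⁻¹) ^ k) / (Q - 1)) atTop (nhds ((Q - 0) / (Q - 1))) :=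
      ((tendsto_pow_atTop_nhds_zero_of_lt_one (by positivity) (inv_lt_one_of_one_lt₀ hQ)).const_sub
        Q).div_const _
    rw [sub_zero] at h3
    refine h3.congr fun k => ?_
    rw [hgeo, inv_pow, pow_succ]
    field_simp
  have h4 := h2.tendsto_div_nhds_zero
  have h5 := (tendsto_add_atTop_iff_nat 1).2 h4
  have h6 := (h5.mul hG).add (hG.const_mul c)
  rw [zero_mul, zero_add] at h6
  refine h6.congr fun k => ?_
  have hpos : (∑ i ∈ Finset.range (k + 1), Q ^ i) ≠ 0 := by
    have : 0 < ∑ i ∈ Finset.range (k + 1), Q ^ i :=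
      Finset.sum_pos (fun i _ => by positivity) ⟨0, by simp⟩
    exact this.ne'
  rw [div_mul_div_cancel₀ hpos, Finset.sum_sub_distrib, ← Finset.mul_sum]
  ring

lemma base_limit {K Place : Type*} [Field K] (deg : Place → ℕ) (prin : Kˣ → (Place →₀ ℤ))
    (hdeg : ∀ p, 0 < deg p)
    (hfin : ∀ n : ℕ, {p : Place | deg p ≤ n}.Finite) (q : ℕ) (hq : 2 ≤ q)
    (hmul : ∀ a b : Kˣ, prin (a * b) = prin a + prin b)
    (hdegprin : ∀ u : Kˣ, divDeg deg (prin u) = 0)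
    (ell : (Place →₀ ℤ) → ℕ)
    (hell : ∀ D : Place →₀ ℤ, Nat.card (Lset prin D) = q ^ ell D)
    (g : ℕ) (Can : Place →₀ ℤ)
    (hRR : ∀ D : Place →₀ ℤ,
      (ell D : ℤ) = divDeg deg D - g + 1 + ell (Can - D))
    (hCan : divDeg deg Can = 2 * (g : ℤ) - 2)
    (d : ℕ) (hd : 0 < d) (D₀ : Place →₀ ℤ) (hD₀ : divDeg deg D₀ = d)
    (hdd : ∀ D, (d : ℤ) ∣ divDeg deg D) :
    ∃ c : ℝ, 0 < c ∧ Tendsto (fun n : ℕ => ((effLe deg n).ncard : ℝ) / (q : ℝ) ^ (d * (n / d)))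
      atTop (nhds c) := by
  obtain ⟨h, b, hh, hb, hA⟩ := exists_card_effEq deg prin hdeg hfin q hq hmul hdegprin ell hell g Can
    hRR hCan d hd D₀ hD₀
  have hq1 : (1 : ℝ) < q := by exact_mod_cast hq
  have hq0 : (0 : ℝ) < q := by linarith
  have hQ : (1 : ℝ) < (q : ℝ) ^ d := one_lt_pow₀ hq1 hd.ne'
  have hb' : (0 : ℝ) < b := by exact_mod_cast hb
  have hh' : (0 : ℝ) < h := by exact_mod_cast hh
  set c₁ : ℝ := h * q / (b * q ^ g) with hc₁
  have h1 : Tendsto (fun k : ℕ => ((effEq deg ((d * k : ℕ) : ℤ)).ncard : ℝ) / ((q : ℝ) ^ d) ^ k) atTop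
      (nhds c₁) := by
    have h3 : Tendsto (fun k : ℕ => c₁ - h / b * (((q : ℝ) ^ d)⁻¹) ^ k) atTop
        (nhds (c₁ - h / b * 0)) :=
      ((tendsto_pow_atTop_nhds_zero_of_lt_one (by positivity)
        (inv_lt_one_of_one_lt₀ hQ)).const_mul _).const_sub _
    rw [mul_zero, sub_zero] at h3
    refine h3.congr' ?_
    filter_upwards [eventually_ge_atTop (2 * g + 1)] with k hk
    obtain ⟨e, he, h4⟩ := hA k hk
    have h5 : ((effEq deg ((d * k : ℕ) : ℤ)).ncard : ℝ) * b + h = h * q ^ e := by exact_mod_cast h4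
    have h6 : (q : ℝ) ^ e * q ^ g = (q ^ d) ^ k * q := by
      rw [← pow_add, he, pow_succ, pow_mul]
    have h7 : (q : ℝ) ^ e = (q ^ d) ^ k * q / q ^ g := by
      rw [eq_div_iff (by positivity), h6]
    have h8 : ((effEq deg ((d * k : ℕ) : ℤ)).ncard : ℝ) = (h * q ^ e - h) / b := by
      rw [eq_div_iff hb'.ne']; linarith
    rw [h8, h7, hc₁, inv_pow]
    field_simp
  have h2 := sum_limit _ hQ _ _ h1
  refine ⟨_, ?_, (h2.comp (Nat.tendsto_div_const_atTop hd.ne')).congr fun n => ?_⟩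
  · have : (0 : ℝ) < q ^ d - 1 := by linarith
    positivity
  · simp only [Function.comp_apply]
    rw [card_effLe deg hdeg hfin d hd hdd n, pow_mul]
    push_cast
    rfl

end Limits

section Final

open Filter

lemma ncard_pi_const {α : Type*} (m : ℕ) (Y : Set α) :
    {F : Fin m → α | ∀ l, F l ∈ Y}.ncard = Y.ncard ^ m := by
  rw [← Nat.card_coe_set_eq, ← Nat.card_coe_set_eq]
  have : Nat.card (Fin m → Y) = Nat.card Y ^ m := by
    rw [Nat.card_fun, Nat.card_fin]
  rw [← this]
  exact Nat.card_congr (Equiv.subtypePiEquivPi (p := fun _ x => x ∈ Y))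

lemma summable_places {Place : Type*} (deg : Place → ℕ) (hdeg : ∀ p, 0 < deg p)
    (hfin : ∀ n : ℕ, {p : Place | deg p ≤ n}.Finite) (q : ℕ) (hq : 2 ≤ q) (B : ℝ)
    (hB : ∀ n : ℕ, ((effLe deg n).ncard : ℝ) ≤ B * (q : ℝ) ^ n) (e : ℕ) (he : 2 ≤ e) :
    Summable (fun p : Place => ((q : ℝ) ^ (e * deg p))⁻¹) := by
  classical
  have hq1 : (1 : ℝ) < q := by exact_mod_cast hq
  have hq0 : (0 : ℝ) < q := by linarith
  have hB0 : 0 ≤ B := by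
    have h1 := hB 0
    have h2 : (0 : ℝ) ≤ ((effLe deg ((0 : ℕ) : ℤ)).ncard : ℝ) := by positivity
    simp only [pow_zero, mul_one] at h1
    linarith
  have hgs : Summable (fun k : ℕ => ((q : ℝ)⁻¹) ^ k) :=
    summable_geometric_of_lt_one (by positivity) (inv_lt_one_of_one_lt₀ hq1)
  refine summable_of_sum_le (c := B * ∑' k : ℕ, ((q : ℝ)⁻¹) ^ k) (fun p => by positivity) fun u => ?_
  calc ∑ p ∈ u, ((q : ℝ) ^ (e * deg p))⁻¹ ≤ ∑ p ∈ u, ((q : ℝ) ^ (2 * deg p))⁻¹ := by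
        refine Finset.sum_le_sum fun p _ => ?_
        have : (q : ℝ) ^ (2 * deg p) ≤ (q : ℝ) ^ (e * deg p) :=
          pow_le_pow_right₀ hq1.le (Nat.mul_le_mul_right _ he)
        exact inv_anti₀ (by positivity) this
    _ = ∑ k ∈ u.image deg, ∑ p ∈ u with deg p = k, ((q : ℝ) ^ (2 * deg p))⁻¹ := by
        rw [Finset.sum_fiberwise_of_maps_to]
        intro p hp; exact Finset.mem_image_of_mem _ hp
    _ ≤ ∑ k ∈ u.image deg, B * ((q : ℝ)⁻¹) ^ k := by
        refine Finset.sum_le_sum fun k _ => ?_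
        have h1 : ∑ p ∈ u with deg p = k, ((q : ℝ) ^ (2 * deg p))⁻¹ =
            ((u.filter (fun p => deg p = k)).card : ℝ) * ((q : ℝ) ^ (2 * k))⁻¹ := by
          rw [← nsmul_eq_mul, ← Finset.sum_const]
          refine Finset.sum_congr rfl fun p hp => ?_
          rw [(Finset.mem_filter.1 hp).2]
        have h2 : (u.filter (fun p => deg p = k)).card ≤ (effLe deg k).ncard := by
          rw [← Set.ncard_coe_finset]
          refine Set.ncard_le_ncard_of_injOn (fun p => Finsupp.single p (1 : ℤ)) ?_ ?_
            (effLe_finite deg hdeg hfin k)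
          · intro p hp
            refine ⟨by simp, ?_⟩
            have : deg p = k := by simpa using (Finset.mem_filter.1 (Finset.mem_coe.1 hp)).2
            rw [divDeg_single, this]; simp
          · intro p _ p' _ h
            exact Finsupp.single_left_injective one_ne_zero h
        have h3 : ((u.filter (fun p => deg p = k)).card : ℝ) ≤ B * (q : ℝ) ^ k :=
          le_trans (by exact_mod_cast h2) (hB k)
        rw [h1]
        calc _ ≤ B * (q : ℝ) ^ k * ((q : ℝ) ^ (2 * k))⁻¹ := by gcongr
          _ = B * ((q : ℝ)⁻¹) ^ k := by
            rw [inv_pow, two_mul, pow_add]; field_simp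
    _ = B * ∑ k ∈ u.image deg, ((q : ℝ)⁻¹) ^ k := by rw [Finset.mul_sum]
    _ ≤ _ := by
        gcongr
        exact hgs.sum_le_tsum _ (fun _ _ => by positivity)

lemma squeeze_limit {ι : Type*} (r : ℕ → ℝ) (u : Finset ι → ℕ → ℝ) (l ε : Finset ι → ℝ) (L : ℝ)
    (hu : ∀ T, Tendsto (u T) atTop (nhds (l T))) (hl : Tendsto l atTop (nhds L))
    (hε : Tendsto ε atTop (nhds 0)) (h1 : ∀ T n, r n ≤ u T n) (h2 : ∀ T n, u T n ≤ r n + ε T) :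
    Tendsto r atTop (nhds L) := by
  rw [tendsto_order]
  constructor
  · intro a ha
    have h3 : Tendsto (fun T => l T - ε T) atTop (nhds (L - 0)) := hl.sub hε
    rw [sub_zero] at h3
    obtain ⟨T, hT⟩ := ((tendsto_order.1 h3).1 a ha).exists
    filter_upwards [(tendsto_order.1 (hu T)).1 (a + ε T) (by linarith)] with n hn
    linarith [h2 T n]
  · intro a ha
    obtain ⟨T, hT⟩ := ((tendsto_order.1 hl).2 a ha).exists
    filter_upwards [(tendsto_order.1 (hu T)).2 a hT] with n hn
    linarith [h1 T n]

lemma prod_limit {ι : Type*} (a : ι → ℝ) (ha : Summable a) (h0 : ∀ i, 0 ≤ a i)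
    (h1 : ∀ i, a i ≤ 1 / 2) :
    Tendsto (fun T : Finset ι => ∏ i ∈ T, (1 - a i)) atTop (nhds (∏' i, (1 - a i)⁻¹)⁻¹) := by
  have hpos : ∀ i, 0 < 1 - a i := fun i => by linarith [h1 i]
  have heq : ∀ i, (1 - a i)⁻¹ = 1 + a i * (1 - a i)⁻¹ := by
    intro i
    have := (hpos i).ne'
    field_simp
    ring
  have hle : ∀ i, (1 - a i)⁻¹ ≤ 2 := by
    intro i
    rw [inv_le_comm₀ (hpos i) (by norm_num)]
    linarith [h1 i]
  have hs : Summable (fun i => a i * (1 - a i)⁻¹) := by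
    refine Summable.of_nonneg_of_le (fun i => mul_nonneg (h0 i) (inv_nonneg.2 (hpos i).le))
      (fun i => ?_) (ha.mul_right 2)
    exact mul_le_mul_of_nonneg_left (hle i) (h0 i)
  have hm : Multipliable (fun i => (1 - a i)⁻¹) := by
    rw [funext heq]
    exact Real.multipliable_one_add_of_summable hs
  have hp : Tendsto (fun T : Finset ι => ∏ i ∈ T, (1 - a i)⁻¹) atTop (nhds (∏' i, (1 - a i)⁻¹)) :=
    hm.hasProd
  have hge : 1 ≤ ∏' i, (1 - a i)⁻¹ := by
    refine ge_of_tendsto' hp fun T => ?_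
    refine Finset.prod_induction _ (fun x : ℝ => 1 ≤ x)
      (fun x y hx hy => one_le_mul_of_one_le_of_one_le hx hy) le_rfl fun i _ => ?_
    rw [heq]
    have := mul_nonneg (h0 i) (inv_nonneg.2 (hpos i).le)
    linarith
  refine (hp.inv₀ (by linarith)).congr fun T => ?_
  rw [Finset.prod_inv_distrib, inv_inv]

end Final
/-- Corollary 2 (density of `w`-coprime ideal tuples): for `w, m ≥ 1` with
`wm ≥ 2`, `lim_{n→∞} Q_{S,m}^w(n) / j_S(n)^m = 1/ζ_S(wm)`: the probability
that `m` random integral ideals of `𝒪_S` of degree at most `n` are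
`w`-coprime tends to `1/ζ_S(wm)` (for `m = 1, w = 2`, the density of
squarefree integral ideals of `𝒪_S` is `1/ζ_S(2)`). -/
theorem density_w_coprime_S_integral_ideals
    {Fq K Place : Type*} [Field Fq] [Fintype Fq] [Field K] [Algebra Fq K]

    (q : ℕ) (hq : Fintype.card Fq = q)
    (deg : Place → ℕ) (hdeg : ∀ p, 0 < deg p)
    (hfin : ∀ n : ℕ, {p : Place | deg p ≤ n}.Finite)
    (prin : Kˣ → (Place →₀ ℤ))
    (hmul : ∀ a b : Kˣ, prin (a * b) = prin a + prin b)
    (hadd : ∀ a b c : Kˣ, (a : K) + (b : K) = (c : K) →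
      ∀ p, min (prin a p) (prin b p) ≤ prin c p)
    (hconst : ∀ c : Fqˣ, prin (Units.map (algebraMap Fq K).toMonoidHom c) = 0)
    (hdegprin : ∀ u : Kˣ, divDeg deg (prin u) = 0)
    (ell : (Place →₀ ℤ) → ℕ)
    (hell : ∀ D : Place →₀ ℤ, Nat.card (Lset prin D) = q ^ ell D)
    (g : ℕ) (Can : Place →₀ ℤ)
    (hRR : ∀ D : Place →₀ ℤ,
      (ell D : ℤ) = divDeg deg D - g + 1 + ell (Can - D))
    (hCan : divDeg deg Can = 2 * (g : ℤ) - 2)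
    (S : Finset Place) (hS : S.Nonempty)
    (w m : ℕ) (hw : 1 ≤ w) (hm : 1 ≤ m) (hwm : 2 ≤ w * m) :
    Tendsto (fun n : ℕ =>
        (Nat.card {F : Fin m → (Place →₀ ℤ) //
            (∀ l, 0 ≤ F l ∧ (∀ p ∈ S, F l p = 0) ∧ divDeg deg (F l) ≤ n) ∧
              wCoprimeIdeals S w F} : ℝ) /
          (Nat.card {D : Place →₀ ℤ //
              (0 ≤ D ∧ ∀ p ∈ S, D p = 0) ∧ divDeg deg D ≤ n} : ℝ) ^ m)
      atTop
      (nhds (∏' p : {p : Place // p ∉ S},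
          (1 - ((q : ℝ) ^ (w * m * deg p.1))⁻¹)⁻¹)⁻¹) := by
  classical
  obtain ⟨p₀, hp₀⟩ := hS
  have hq2 : 2 ≤ q := by rw [← hq]; exact Fintype.one_lt_card
  have hq1 : (1 : ℝ) < q := by exact_mod_cast hq2
  have hq0 : (0 : ℝ) < q := by linarith
  obtain ⟨d, hd, ⟨D₀, hD₀⟩, hdd⟩ := exists_index deg hdeg p₀
  have hdp : ∀ p, d ∣ deg p := by
    intro p
    have := hdd (Finsupp.single p 1)
    rw [divDeg_single, one_mul] at this
    exact_mod_cast this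
  obtain ⟨c, hc, hlim⟩ := base_limit deg prin hdeg hfin q hq2 hmul hdegprin ell hell g Can hRR hCan
    d hd D₀ hD₀ hdd
  set N : ℕ → ℝ := fun n => (q : ℝ) ^ (d * (n / d)) with hN
  have hNpos : ∀ n, 0 < N n := fun n => by simp only [hN]; positivity
  -- summability
  obtain ⟨B₀, hB₀⟩ := hlim.bddAbove_range
  have hB₀' : ∀ n : ℕ, ((effLe deg n).ncard : ℝ) ≤ B₀ * N n := by
    intro n
    have := hB₀ ⟨n, rfl⟩
    exact (div_le_iff₀ (hNpos n)).1 this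
  have hB₀0 : 0 ≤ B₀ := le_trans (by positivity) (hB₀ ⟨0, rfl⟩)
  have hsumP := summable_places deg hdeg hfin q hq2 B₀ (fun n => (hB₀' n).trans (by
    gcongr
    simp only [hN]
    exact pow_le_pow_right₀ hq1.le (Nat.mul_div_le n d))) (w * m) hwm
  set a : {p : Place // p ∉ S} → ℝ := fun p => ((q : ℝ) ^ (w * m * deg p.1))⁻¹ with ha
  have hsum : Summable a := hsumP.subtype _
  have ha0 : ∀ p, 0 ≤ a p := fun p => by simp only [ha]; positivity
  have ha1 : ∀ p, a p ≤ 1 / 2 := by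
    intro p
    simp only [ha]
    rw [one_div]
    apply inv_anti₀ (by norm_num)
    have h1 : (2 : ℝ) ≤ q := by exact_mod_cast hq2
    refine h1.trans (le_self_pow₀ hq1.le ?_)
    have := hdeg p.1
    positivity
  have hprod := prod_limit a hsum ha0 ha1
  -- the counting function of ideals
  set Y : ℤ → Set (Place →₀ ℤ) := fun n => {D | (0 ≤ D ∧ ∀ p ∈ S, D p = 0) ∧ divDeg deg D ≤ n}
    with hY
  have hYsub : ∀ n, Y n ⊆ effLe deg n := fun n D h => ⟨h.1.1, h.2⟩
  have hYfin : ∀ n, (Y n).Finite := fun n => (effLe_finite deg hdeg hfin n).subset (hYsub n)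
  obtain ⟨cS, hcS, hYlim⟩ : ∃ cS : ℝ, 0 < cS ∧
      Tendsto (fun n : ℕ => ((Y n).ncard : ℝ) / N n) atTop (nhds cS) := by
    have h0 : Tendsto (fun n : ℕ => (((Set.univ : Set (Fin 1 → Place →₀ ℤ)) ∩ tupLe deg 1 n).ncard : ℝ) /
        ((q : ℝ) ^ (d * (n / d))) ^ 1) atTop (nhds c) := by
      refine hlim.congr fun n => ?_
      rw [Set.univ_inter, pow_one]
      have := ncard_pi_const 1 (effLe deg n)
      rw [pow_one] at this
      rw [← this]
      rfl
    have h1 := limit_good deg hdeg hfin hd hq2 hdp 1 1 Set.univ c h0 S (fun _ _ _ => by simp)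
    refine ⟨_, ?_, h1.congr fun n => ?_⟩
    · refine mul_pos hc (Finset.prod_pos fun p _ => ?_)
      rw [sub_pos]
      refine inv_lt_one_of_one_lt₀ (one_lt_pow₀ hq1 ?_)
      have := hdeg p
      omega
    · rw [pow_one]
      congr 2
      have := ncard_pi_const 1 (Y n)
      rw [pow_one] at this
      rw [← this]
      congr 1
      ext F
      simp only [Set.univ_inter, Set.mem_inter_iff, goodOn, badAt, tupLe, effLe, hY, Set.mem_ofPred_eq,
        Fin.forall_fin_one, SetLike.mem_coe]
      constructor
      · rintro ⟨h2, h3, h4⟩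
        refine ⟨⟨h3, fun p hp => ?_⟩, h4⟩
        have h5 := h2 p hp
        have h6 : 0 ≤ F 0 p := h3 p
        push_cast at h5
        omega
      · rintro ⟨⟨h3, h2⟩, h4⟩
        refine ⟨fun p hp => ?_, h3, h4⟩
        rw [h2 p hp]; norm_num
  obtain ⟨B, hB⟩ := hYlim.bddAbove_range
  have hB' : ∀ n : ℕ, ((Y n).ncard : ℝ) ≤ B * N n := by
    intro n
    have := hB ⟨n, rfl⟩
    exact (div_le_iff₀ (hNpos n)).1 this
  -- tuples
  set X : Set (Fin m → Place →₀ ℤ) := {F | ∀ l, ∀ p ∈ S, F l p = 0} with hX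
  have hXY : ∀ n : ℤ, X ∩ tupLe deg m n = {F | ∀ l, F l ∈ Y n} := by
    intro n
    ext F
    simp only [hX, hY, tupLe, effLe, Set.mem_inter_iff, Set.mem_ofPred_eq]
    constructor
    · rintro ⟨h1, h2⟩ l
      exact ⟨⟨(h2 l).1, h1 l⟩, (h2 l).2⟩
    · intro h
      exact ⟨fun l => (h l).1.2, fun l => ⟨(h l).1.1, (h l).2⟩⟩
  have hXcard : ∀ n : ℤ, (X ∩ tupLe deg m n).ncard = (Y n).ncard ^ m := by
    intro n
    rw [hXY, ncard_pi_const]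
  have hXshift : ∀ p, p ∉ S → ∀ F, (F + fun _ => Finsupp.single p (w : ℤ)) ∈ X ↔ F ∈ X := by
    intro p hp F
    simp only [hX, Set.mem_ofPred_eq]
    refine forall_congr' fun l => forall₂_congr fun x hx => ?_
    have : p ≠ x := by rintro rfl; exact hp hx
    simp [this]
  have hXlim : Tendsto (fun n : ℕ => ((X ∩ tupLe deg m n).ncard : ℝ) / (N n) ^ m) atTop
      (nhds (cS ^ m)) := by
    refine (hYlim.pow m).congr fun n => ?_
    rw [hXcard, div_pow]
    push_cast
    rfl
  set G : ℕ → Set (Fin m → Place →₀ ℤ) := fun n => X ∩ goodOn m w {p | p ∉ S} ∩ tupLe deg m n with hG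
  set GT : Finset {p : Place // p ∉ S} → ℕ → Set (Fin m → Place →₀ ℤ) := fun T n =>
    X ∩ goodOn m w ((T.map (Function.Embedding.subtype _) : Finset Place) : Set Place) ∩ tupLe deg m n
    with hGT
  have htf : ∀ n : ℕ, (tupLe deg m n).Finite := fun n => tupLe_finite deg hdeg hfin m n
  have hGTlim : ∀ T, Tendsto (fun n : ℕ => ((GT T n).ncard : ℝ) / (N n) ^ m) atTop
      (nhds (cS ^ m * ∏ p ∈ T, (1 - a p))) := by
    intro T
    have := limit_good deg hdeg hfin hd hq2 hdp m w X (cS ^ m) hXlim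
      (T.map (Function.Embedding.subtype _)) (by
        intro p hp
        obtain ⟨x, _, rfl⟩ := Finset.mem_map.1 hp
        exact hXshift _ x.2)
    rw [Finset.prod_map] at this
    exact this
  have hsub : ∀ T n, G n ⊆ GT T n := by
    rintro T n F ⟨⟨h1, h2⟩, h3⟩
    refine ⟨⟨h1, fun p hp => h2 p ?_⟩, h3⟩
    obtain ⟨x, _, rfl⟩ := Finset.mem_map.1 (Finset.mem_coe.1 hp)
    exact x.2
  have hupper : ∀ T n, ((G n).ncard : ℝ) / (N n) ^ m ≤ ((GT T n).ncard : ℝ) / (N n) ^ m := by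
    intro T n
    have := Set.ncard_le_ncard (hsub T n) ((htf n).subset Set.inter_subset_right)
    have h2 := hNpos n
    gcongr
  have hbadcard : ∀ (n : ℕ) (p : {p : Place // p ∉ S}), w * deg p.1 ≤ n →
      ((X ∩ tupLe deg m n ∩ badAt m w p.1).ncard : ℝ) ≤ B ^ m * N n ^ m * a p := by
    intro n p hpn
    rw [ncard_bad deg w p.1 X (hXshift _ p.2), hXcard]
    rw [← Nat.cast_sub hpn]
    obtain ⟨k, rfl⟩ := Nat.exists_eq_add_of_le' hpn
    rw [Nat.add_sub_cancel]
    have h1 : N (k + w * deg p.1) = N k * (q : ℝ) ^ (w * deg p.1) := by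
      obtain ⟨j, hj⟩ := (hdp p.1).mul_left w
      simp only [hN]
      rw [hj, Nat.add_mul_div_left _ _ hd, mul_add, pow_add]
    have h2 : B ^ m * N (k + w * deg p.1) ^ m * a p = (B * N k) ^ m := by
      rw [h1]
      simp only [ha]
      rw [show w * m * deg p.1 = (w * deg p.1) * m by ring, pow_mul (q : ℝ) (w * deg p.1) m, mul_pow,
        mul_pow]
      field_simp
    rw [h2]
    push_cast
    exact pow_le_pow_left₀ (by positivity) (hB' k) m
  have hlower : ∀ T n, ((GT T n).ncard : ℝ) / (N n) ^ m ≤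
      ((G n).ncard : ℝ) / (N n) ^ m + B ^ m * (∑' p, a p - ∑ p ∈ T, a p) := by
    intro T n
    have hPf : {p : {p : Place // p ∉ S} | p ∉ T ∧ w * deg p.1 ≤ n}.Finite := by
      refine Set.Finite.of_finite_image (f := Subtype.val) ((hfin n).subset ?_)
        Subtype.val_injective.injOn
      rintro _ ⟨p, ⟨_, hp⟩, rfl⟩
      exact (Nat.le_mul_of_pos_left _ hw).trans hp
    set P := hPf.toFinset with hP
    have hcov : GT T n ⊆ G n ∪ ⋃ p ∈ P, (X ∩ tupLe deg m n ∩ badAt m w p.1) := by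
      rintro F ⟨⟨h1, h2⟩, h3⟩
      by_cases hF : F ∈ goodOn m w {p | p ∉ S}
      · exact Or.inl ⟨⟨h1, hF⟩, h3⟩
      · right
        simp only [goodOn, Set.mem_ofPred_eq, not_forall, not_not] at hF
        obtain ⟨p, hp, hbad⟩ := hF
        refine Set.mem_iUnion₂.2 ⟨⟨p, hp⟩, ?_, ⟨h1, h3⟩, hbad⟩
        rw [hP, Set.Finite.mem_toFinset]
        refine ⟨fun hT => h2 p ?_ hbad, ?_⟩
        · simpa using ⟨hp, hT⟩
        · have h4 := h3 ⟨0, hm⟩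
          have h5 := le_divDeg deg h4.1 p
          have h6 := h4.2
          have h7 := hbad ⟨0, hm⟩
          have h8 : (w : ℤ) * deg p ≤ n :=
            (mul_le_mul_of_nonneg_right h7 (by positivity)).trans (h5.trans h6)
          exact_mod_cast h8
    have hfinU : (G n ∪ ⋃ p ∈ P, (X ∩ tupLe deg m n ∩ badAt m w p.1)).Finite := by
      refine (htf n).subset (Set.union_subset Set.inter_subset_right ?_)
      exact Set.iUnion₂_subset fun p _ F hF => hF.1.2
    have hcard : (GT T n).ncard ≤ (G n).ncard +
        ∑ p ∈ P, (X ∩ tupLe deg m n ∩ badAt m w p.1).ncard :=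
      (Set.ncard_le_ncard hcov hfinU).trans ((Set.ncard_union_le _ _).trans
        (Nat.add_le_add_left (Finset.set_ncard_biUnion_le _ _) _))
    have hB0 : 0 ≤ B := le_trans (by have := hNpos 0; positivity) (hB ⟨0, rfl⟩)
    have hNn := hNpos n
    have h1 : ((GT T n).ncard : ℝ) ≤ (G n).ncard + B ^ m * N n ^ m * ∑ p ∈ P, a p := by
      calc ((GT T n).ncard : ℝ) ≤ (G n).ncard +
            ∑ p ∈ P, ((X ∩ tupLe deg m n ∩ badAt m w p.1).ncard : ℝ) := by exact_mod_cast hcard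
        _ ≤ _ := by
          rw [Finset.mul_sum]
          gcongr with p hp
          rw [hP, Set.Finite.mem_toFinset] at hp
          exact hbadcard n p hp.2
    have hdisj : Disjoint T P := by
      rw [Finset.disjoint_right]
      intro p hp
      rw [hP, Set.Finite.mem_toFinset] at hp
      exact hp.1
    have h2 : ∑ p ∈ P, a p ≤ ∑' p, a p - ∑ p ∈ T, a p := by
      have := hsum.sum_le_tsum (T ∪ P) (fun p _ => ha0 p)
      rw [Finset.sum_union hdisj] at this
      linarith
    rw [div_add' _ _ _ (by positivity)]
    gcongr
    refine h1.trans ?_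
    have h3 : B ^ m * N n ^ m * ∑ p ∈ P, a p ≤ B ^ m * N n ^ m * (∑' p, a p - ∑ p ∈ T, a p) := by
      gcongr
    linarith
  have hε : Tendsto (fun T => B ^ m * (∑' p, a p - ∑ p ∈ T, a p)) atTop (nhds 0) := by
    have h1 : Tendsto (fun T => ∑ p ∈ T, a p) atTop (nhds (∑' p, a p)) := hsum.hasSum
    have := (h1.const_sub (∑' p, a p)).const_mul (B ^ m)
    rwa [sub_self, mul_zero] at this
  have hGlim := squeeze_limit (fun n => ((G n).ncard : ℝ) / (N n) ^ m)
    (fun T n => ((GT T n).ncard : ℝ) / (N n) ^ m) _ _ _ hGTlim (hprod.const_mul (cS ^ m)) hε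
    hupper hlower
  have hfinal := hGlim.div (hYlim.pow m) (by positivity)
  rw [mul_div_cancel_left₀ _ (by positivity)] at hfinal
  refine hfinal.congr fun n => ?_
  have hNn := hNpos n
  simp only [Pi.div_apply]
  rw [div_pow, div_div_div_cancel_right₀ (by positivity)]
  have e1 : G n = {F : Fin m → (Place →₀ ℤ) |
            (∀ l, 0 ≤ F l ∧ (∀ p ∈ S, F l p = 0) ∧ divDeg deg (F l) ≤ n) ∧
              wCoprimeIdeals S w F} := by
    ext F
    simp only [hG, hX, goodOn, badAt, tupLe, effLe, wCoprimeIdeals, Set.mem_inter_iff,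
      Set.mem_ofPred_eq, not_exists, not_and]
    constructor
    · rintro ⟨⟨h1, h2⟩, h3⟩
      exact ⟨fun l => ⟨(h3 l).1, h1 l, (h3 l).2⟩, h2⟩
    · rintro ⟨h1, h2⟩
      exact ⟨⟨fun l => (h1 l).2.1, h2⟩, fun l => ⟨(h1 l).1, (h1 l).2.2⟩⟩
  rw [e1]
  rfl
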